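/- Let F be a finite family of strong Pouna sets satisfying constraints (C1) and (C2). If A, B, C ∈ F, A ↷ B and B ≺ C, then A ↷ C or A ≺ C. -/

import Mathlib

open Set

noncomputable def lS (S : Set (ℝ × ℝ)) : ℝ := sInf (Prod.fst '' S)
noncomputable def rS (S : Set (ℝ × ℝ)) : ℝ := sSup (Prod.fst '' S)
noncomputable def bS (S : Set (ℝ × ℝ)) : ℝ := sInf (Prod.snd '' S)
noncomputable def tS (S : Set (ℝ × ℝ)) : ℝ := sSup (Prod.snd '' S)

/-- The bounding box of a bounded set in the plane. -/
noncomputable def boxS (S : Set (ℝ × ℝ)) : Set (ℝ × ℝ) :=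
  Icc (lS S) (rS S) ×ˢ Icc (bS S) (tS S)

/-- A Pouna set: nonempty, compact, path-connected, not an axis-parallel rectangle. -/
def Pouna (S : Set (ℝ × ℝ)) : Prop :=
  S.Nonempty ∧ IsCompact S ∧ IsPathConnected S ∧
    ¬ ∃ a b c d : ℝ, S = Icc a b ×ˢ Icc c d

/-- The territory of a set. -/
def Ter (S : Set (ℝ × ℝ)) : Set (ℝ × ℝ) :=
  {p | p ∈ boxS S \ S ∧ ∃ x' > p.1, (x', p.2) ∈ S}

/-- A strong Pouna set: a Pouna set with nonempty territory. -/
def Strong (S : Set (ℝ × ℝ)) : Prop := Pouna S ∧ (Ter S).Nonempty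

/-- `Prec A B` (`A ≺ B`): the bounding box of `A` is inside the territory of `B`. -/
def Prec (A B : Set (ℝ × ℝ)) : Prop := boxS A ⊆ Ter B

/-- `Adj A B` (`A ↷ B`). -/
def Adj (A B : Set (ℝ × ℝ)) : Prop :=
  A ≠ B ∧ (A ∩ B).Nonempty ∧
  lS B ≤ lS A ∧ lS A < rS B ∧ rS B < rS A ∧
  bS B < bS A ∧ bS A < tS A ∧ tS A < tS B ∧
  {p : ℝ × ℝ | p ∈ A ∧ p.1 = lS A} ⊆ Ter B

def ConstraintC1 (F : Set (Set (ℝ × ℝ))) : Prop :=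
  ∀ A ∈ F, ∀ B ∈ F, A ≠ B → (A ∩ B).Nonempty → Adj A B ∨ Adj B A

def ConstraintC2 (F : Set (Set (ℝ × ℝ))) : Prop :=
  ∀ A ∈ F, ∀ B ∈ F, A ∩ B = ∅ → (A ∩ Ter B).Nonempty → Prec A B

def ConstraintC3 (F : Set (Set (ℝ × ℝ))) : Prop :=
  ∀ A ∈ F, ∀ B ∈ F, A ≠ B → (A ∩ B).Nonempty → ¬ ∃ C ∈ F, C ⊆ Ter A ∩ Ter B

def ConstraintC4 (F : Set (Set (ℝ × ℝ))) : Prop :=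
  ¬ ∃ A ∈ F, ∃ B ∈ F, ∃ C ∈ F, Prec A B ∧ Adj A C ∧ Adj B C

def ConstraintC5 (F : Set (Set (ℝ × ℝ))) : Prop :=
  ¬ ∃ A ∈ F, ∃ B ∈ F, ∃ C ∈ F, A ≠ B ∧ A ≠ C ∧ B ≠ C ∧
    (A ∩ B).Nonempty ∧ (A ∩ C).Nonempty ∧ (B ∩ C).Nonempty

theorem subset_boxS {S : Set (ℝ × ℝ)} (hS : IsCompact S) : S ⊆ boxS S := by
  intro p hp
  have h1 := hS.image continuous_fst
  have h2 := hS.image continuous_snd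
  exact ⟨⟨csInf_le h1.bddBelow ⟨p, hp, rfl⟩, le_csSup h1.bddAbove ⟨p, hp, rfl⟩⟩,
    ⟨csInf_le h2.bddBelow ⟨p, hp, rfl⟩, le_csSup h2.bddAbove ⟨p, hp, rfl⟩⟩⟩

/-- Axiom (A4) for a finite family of strong Pouna sets satisfying (C1), (C2). -/
theorem stmt_9 (F : Set (Set (ℝ × ℝ))) (hfin : F.Finite)
    (hstrong : ∀ S ∈ F, Strong S)
    (h1 : ConstraintC1 F) (h2 : ConstraintC2 F)
    (A B C : Set (ℝ × ℝ)) (hA : A ∈ F) (hB : B ∈ F) (hC : C ∈ F)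
    (hAB : Adj A B) (hBC : Prec B C) :
    Adj A C ∨ Prec A C := by
  obtain ⟨-, ⟨p, hpA, hpB⟩, hl, hl', -, hb, hb', ht, -⟩ := hAB
  have hpC : p ∈ Ter C := hBC (subset_boxS (hstrong B hB).1.2.1 hpB)
  have hne : A ≠ C := by
    rintro rfl
    exact hpC.1.2 hpA
  rcases (A ∩ C).eq_empty_or_nonempty with hAC | hAC
  · exact Or.inr (h2 A hA C hC hAC ⟨p, hpA, hpC⟩)
  · refine Or.inl ((h1 A hA C hC hne hAC).resolve_right fun hCA => ?_)
    have hcorner : (lS B, bS B) ∈ boxS B :=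
      ⟨⟨le_rfl, (hl.trans_lt hl').le⟩, ⟨le_rfl, (hb.trans (hb'.trans ht)).le⟩⟩
    have hCB : bS C ≤ bS B := (hBC hcorner).1.1.2.1
    obtain ⟨-, -, -, -, -, hAC', -⟩ := hCA
    linarith
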